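/- arXiv:0710.5143 — 13 statements merged into one kernel-verified Lean document; each statement's English description precedes it below -/
import Mathlib

section
/- Let g0, g2, g4 : ℝ → ℝ be analytic functions and consider the planar differential system ẋ = -y, ẏ = g0(x) + g2(x)y² + g4(x)y⁴. Suppose h0, h2, h4 : ℝ → ℝ are C¹ functions satisfying the linear system h4'(x) - 2g2(x)h4(x) + 2g4(x)h2(x) = 0, h2'(x) - 4g0(x)h4(x) + 4g4(x)h0(x) = 0, and h0'(x) - 2g0(x)h2(x) + 2g2(x)h0(x) = 0. Then V(x,y) = h0(x) + h2(x)y² + h4(x)y⁴ satisfies the inverse integrating factor equation P ∂V/∂x + Q ∂V/∂y = (∂P/∂x + ∂Q/∂y)·V for this system. -/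
/-- If `h0, h2, h4` solve the given linear system, then
`V(x,y) = h0(x) + h2(x) y² + h4(x) y⁴` satisfies the inverse integrating factor
equation for the system `ẋ = -y`, `ẏ = g0(x) + g2(x) y² + g4(x) y⁴`. -/
theorem stmt_0 (g0 g2 g4 h0 h2 h4 : ℝ → ℝ)
    (hg0 : ∀ x, AnalyticAt ℝ g0 x) (hg2 : ∀ x, AnalyticAt ℝ g2 x)
    (hg4 : ∀ x, AnalyticAt ℝ g4 x)
    (hh0 : ContDiff ℝ 1 h0) (hh2 : ContDiff ℝ 1 h2) (hh4 : ContDiff ℝ 1 h4)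
    (e1 : ∀ x, deriv h4 x - 2 * g2 x * h4 x + 2 * g4 x * h2 x = 0)
    (e2 : ∀ x, deriv h2 x - 4 * g0 x * h4 x + 4 * g4 x * h0 x = 0)
    (e3 : ∀ x, deriv h0 x - 2 * g0 x * h2 x + 2 * g2 x * h0 x = 0) :
    ∀ x y : ℝ,
      (-y) * deriv (fun s => h0 s + h2 s * y ^ 2 + h4 s * y ^ 4) x
        + (g0 x + g2 x * y ^ 2 + g4 x * y ^ 4)
            * deriv (fun t => h0 x + h2 x * t ^ 2 + h4 x * t ^ 4) y
      = (deriv (fun _ : ℝ => -y) x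
          + deriv (fun t => g0 x + g2 x * t ^ 2 + g4 x * t ^ 4) y)
        * (h0 x + h2 x * y ^ 2 + h4 x * y ^ 4) := by
  intro x y
  have deriv_even (a b c : ℝ) :
      deriv (fun t => a + b * t ^ 2 + c * t ^ 4) y = 2 * b * y + 4 * c * y ^ 3 := by
    have h := (((hasDerivAt_pow 2 y).const_mul b).const_add a).add
      ((hasDerivAt_pow 4 y).const_mul c)
    refine h.deriv.trans ?_
    norm_num
    ring
  have deriv_coeffs : deriv (fun s => h0 s + h2 s * y ^ 2 + h4 s * y ^ 4) x
      = deriv h0 x + deriv h2 x * y ^ 2 + deriv h4 x * y ^ 4 :=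
    (((hh0.differentiable one_ne_zero x).hasDerivAt.add
      ((hh2.differentiable one_ne_zero x).hasDerivAt.mul_const _)).add
      ((hh4.differentiable one_ne_zero x).hasDerivAt.mul_const _)).deriv
  rw [deriv_even, deriv_even, deriv_coeffs, deriv_const]
  linear_combination -y * e3 x - y ^ 3 * e2 x - y ^ 5 * e1 x
end

section
/- Let g0, g2, g4 : ℝ → ℝ be analytic functions with g4(x) ≠ 0 on an open interval, and consider the planar differential system ẋ = -y, ẏ = g0(x) + g2(x)y² + g4(x)y⁴. Suppose h̃2 : ℝ → ℝ is a C² solution of the second-order linear differential equation g4(x)h̃2''(x) - g4'(x)h̃2'(x) + (g2(x)g4'(x) - g2'(x)g4(x) + 4g0(x)g4(x)² - g2(x)²g4(x))h̃2(x) = 0, and define h̃0(x) = (g2(x)h̃2(x) - h̃2'(x))/(2g4(x)). Then V(x,y) = (h̃0(x) + h̃2(x)y²)² satisfies the inverse integrating factor equation P ∂V/∂x + Q ∂V/∂y = (∂P/∂x + ∂Q/∂y)·V for this system. -/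
/-- If `h̃2` is a C² solution of the second-order linear ODE
`g4 h̃2'' - g4' h̃2' + (g2 g4' - g2' g4 + 4 g0 g4² - g2² g4) h̃2 = 0` on an open
interval where `g4 ≠ 0`, and `h̃0 = (g2 h̃2 - h̃2')/(2 g4)`, then
`V(x,y) = (h̃0(x) + h̃2(x) y²)²` satisfies the inverse integrating factor equation
for the system `ẋ = -y`, `ẏ = g0(x) + g2(x) y² + g4(x) y⁴`. -/
theorem stmt_1 (g0 g2 g4 h2 h0 : ℝ → ℝ) (a b : ℝ) (hab : a < b)
    (hg0 : ∀ x, AnalyticAt ℝ g0 x) (hg2 : ∀ x, AnalyticAt ℝ g2 x)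
    (hg4 : ∀ x, AnalyticAt ℝ g4 x)
    (hg4ne : ∀ x ∈ Set.Ioo a b, g4 x ≠ 0)
    (hh2 : ContDiffOn ℝ 2 h2 (Set.Ioo a b))
    (ode : ∀ x ∈ Set.Ioo a b,
      g4 x * deriv (deriv h2) x - deriv g4 x * deriv h2 x
        + (g2 x * deriv g4 x - deriv g2 x * g4 x + 4 * g0 x * g4 x ^ 2
            - g2 x ^ 2 * g4 x) * h2 x = 0)
    (hh0 : ∀ x ∈ Set.Ioo a b,
      h0 x = (g2 x * h2 x - deriv h2 x) / (2 * g4 x)) :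
    ∀ x ∈ Set.Ioo a b, ∀ y : ℝ,
      (-y) * deriv (fun s => (h0 s + h2 s * y ^ 2) ^ 2) x
        + (g0 x + g2 x * y ^ 2 + g4 x * y ^ 4)
            * deriv (fun t => (h0 x + h2 x * t ^ 2) ^ 2) y
      = (deriv (fun _ : ℝ => -y) x
          + deriv (fun t => g0 x + g2 x * t ^ 2 + g4 x * t ^ 4) y)
        * (h0 x + h2 x * y ^ 2) ^ 2 := by
  intro x hx y
  have hU : Set.Ioo a b ∈ nhds x := isOpen_Ioo.mem_nhds hx
  have hg : g4 x ≠ 0 := hg4ne x hx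
  have d2 : HasDerivAt g2 (deriv g2 x) x := (hg2 x).differentiableAt.hasDerivAt
  have d4 : HasDerivAt g4 (deriv g4 x) x := (hg4 x).differentiableAt.hasDerivAt
  have dh : HasDerivAt h2 (deriv h2 x) x :=
    ((hh2.differentiableOn (by norm_num)).differentiableAt hU).hasDerivAt
  have hh2' : ContDiffOn ℝ 1 (deriv h2) (Set.Ioo a b) :=
    hh2.deriv_of_isOpen isOpen_Ioo (by norm_num)
  have ddh : HasDerivAt (deriv h2) (deriv (deriv h2) x) x :=
    ((hh2'.differentiableOn (by norm_num)).differentiableAt hU).hasDerivAt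
  have dh0 := (((d2.fun_mul dh).fun_sub ddh).fun_div (d4.const_mul 2)
    (mul_ne_zero two_ne_zero hg)).congr_of_eventuallyEq
      (Filter.eventually_of_mem hU hh0 : h0 =ᶠ[nhds x] _)
  have dVx := (dh0.fun_add (dh.mul_const (y ^ 2))).fun_pow 2
  have dy (n : ℕ) (c : ℝ) : HasDerivAt (fun t : ℝ => c * t ^ n) (c * (n * y ^ (n - 1))) y :=
    (hasDerivAt_pow n y).const_mul c
  have dVy := ((dy 2 (h2 x)).const_add (h0 x)).fun_pow 2
  have dQ := ((dy 2 (g2 x)).const_add (g0 x)).fun_add (dy 4 (g4 x))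
  rw [dVx.deriv, dVy.deriv, dQ.deriv, deriv_const, hh0 x hx]
  have hode := ode x hx
  generalize deriv (deriv h2) x = w at *
  have hw : w = (deriv g4 x * deriv h2 x
      - (g2 x * deriv g4 x - deriv g2 x * g4 x + 4 * g0 x * g4 x ^ 2
        - g2 x ^ 2 * g4 x) * h2 x) / g4 x := by
    rw [eq_div_iff hg]
    linear_combination hode
  subst hw
  push_cast
  field_simp
  ring
end

section
/- Let g0, g2, g4 : ℝ → ℝ be sufficiently smooth functions with g4 nonvanishing on an open interval. If A and B are two solutions of the second-order linear differential equation g4 w'' - g4' w' + (g2 g4' - g2' g4 + 4 g0 g4² - g2² g4) w = 0, then the product h = A·B is a solution of the third-order linear differential equation g4² h''' - 3 g4 g4' h'' + (-4g2²g4² + 16g0g4³ - 4g4²g2' + 4g2g4g4' + 3g4'² - g4g4'') h' + 2((4(g4g0' - g0g4') - 2g2g2' - g2'')g4² + (2g2² + 3g2')g4g4' - 3g2g4'² + g2g4g4'') h = 0. In particular, if A, B are two linearly independent solutions of the second-order equation, then A², AB and B² are solutions of the third-order equation. -/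
/-- The third-order linear differential equation of Example 1, evaluated at `x`,
for the unknown function `h`. -/
def ThirdOrderEq (g0 g2 g4 h : ℝ → ℝ) (x : ℝ) : Prop :=
  g4 x ^ 2 * deriv (deriv (deriv h)) x
    - 3 * g4 x * deriv g4 x * deriv (deriv h) x
    + (-4 * g2 x ^ 2 * g4 x ^ 2 + 16 * g0 x * g4 x ^ 3
        - 4 * g4 x ^ 2 * deriv g2 x + 4 * g2 x * g4 x * deriv g4 x
        + 3 * (deriv g4 x) ^ 2 - g4 x * deriv (deriv g4) x) * deriv h x
    + 2 * ((4 * (g4 x * deriv g0 x - g0 x * deriv g4 x)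
          - 2 * g2 x * deriv g2 x - deriv (deriv g2) x) * g4 x ^ 2
        + (2 * g2 x ^ 2 + 3 * deriv g2 x) * g4 x * deriv g4 x
        - 3 * g2 x * (deriv g4 x) ^ 2
        + g2 x * g4 x * deriv (deriv g4) x) * h x = 0

/-- On an open set, a `C^n` function with `n ≠ 0` has its `deriv` as derivative. -/
lemma hasDerivAt_deriv_of_contDiffOn {f : ℝ → ℝ} {s : Set ℝ} {n : WithTop ℕ∞} (hs : IsOpen s)
    (hf : ContDiffOn ℝ n f s) (hn : n ≠ 0) {x : ℝ} (hx : x ∈ s) : HasDerivAt f (deriv f x) x :=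
  ((hf.differentiableOn hn).differentiableAt (hs.mem_nhds hx)).hasDerivAt

/-- The derivative of the second-order equation
`g4 w'' - g4' w' + (g2 g4' - g2' g4 + 4 g0 g4² - g2² g4) w = 0`. -/
lemma deriv_secondOrderEq {g0 g2 g4 w : ℝ → ℝ} {s : Set ℝ} (hs : IsOpen s)
    (hg0 : ContDiffOn ℝ 1 g0 s) (hg2 : ContDiffOn ℝ 2 g2 s) (hg4 : ContDiffOn ℝ 2 g4 s)
    (hw : ContDiffOn ℝ 3 w s)
    (ode : ∀ x ∈ s,
      g4 x * deriv (deriv w) x - deriv g4 x * deriv w x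
        + (g2 x * deriv g4 x - deriv g2 x * g4 x + 4 * g0 x * g4 x ^ 2
            - g2 x ^ 2 * g4 x) * w x = 0) {x : ℝ} (hx : x ∈ s) :
    g4 x * deriv (deriv (deriv w)) x - deriv (deriv g4) x * deriv w x
      + (g2 x * deriv (deriv g4) x - deriv (deriv g2) x * g4 x + 4 * deriv g0 x * g4 x ^ 2
          + 8 * g0 x * g4 x * deriv g4 x - 2 * g2 x * deriv g2 x * g4 x
          - g2 x ^ 2 * deriv g4 x) * w x
      + (g2 x * deriv g4 x - deriv g2 x * g4 x + 4 * g0 x * g4 x ^ 2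
          - g2 x ^ 2 * g4 x) * deriv w x = 0 := by
  have hw1 : ContDiffOn ℝ 2 (deriv w) s := hw.deriv_of_isOpen hs (by norm_num)
  have hw2 : ContDiffOn ℝ 1 (deriv (deriv w)) s := hw1.deriv_of_isOpen hs (by norm_num)
  have hg2' : ContDiffOn ℝ 1 (deriv g2) s := hg2.deriv_of_isOpen hs (by norm_num)
  have hg4' : ContDiffOn ℝ 1 (deriv g4) s := hg4.deriv_of_isOpen hs (by norm_num)
  have dw := hasDerivAt_deriv_of_contDiffOn hs hw (by norm_num) hx
  have dw1 := hasDerivAt_deriv_of_contDiffOn hs hw1 (by norm_num) hx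
  have dw2 := hasDerivAt_deriv_of_contDiffOn hs hw2 (by norm_num) hx
  have dg0 := hasDerivAt_deriv_of_contDiffOn hs hg0 (by norm_num) hx
  have dg2 := hasDerivAt_deriv_of_contDiffOn hs hg2 (by norm_num) hx
  have dg4 := hasDerivAt_deriv_of_contDiffOn hs hg4 (by norm_num) hx
  have dg2' := hasDerivAt_deriv_of_contDiffOn hs hg2' (by norm_num) hx
  have dg4' := hasDerivAt_deriv_of_contDiffOn hs hg4' (by norm_num) hx
  have hode := ((dg4.mul dw2).sub (dg4'.mul dw1)).add
    (((((dg2.mul dg4').sub (dg2'.mul dg4)).add ((dg0.const_mul 4).mul (dg4.pow 2))).sub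
      ((dg2.pow 2).mul dg4)).mul dw)
  have hzero := (hasDerivAt_const x (0 : ℝ)).congr_of_eventuallyEq
    (Filter.eventually_of_mem (hs.mem_nhds hx) ode)
  have key := hode.unique hzero
  simp only [Pi.mul_apply, Pi.sub_apply, Pi.add_apply, Pi.pow_apply] at key
  push_cast at key
  linear_combination key

/-- The product of two solutions of the second-order equation solves the third-order equation. -/
lemma thirdOrderEq_mul {g0 g2 g4 A B : ℝ → ℝ} {s : Set ℝ} (hs : IsOpen s)
    (hg0 : ContDiffOn ℝ 1 g0 s) (hg2 : ContDiffOn ℝ 2 g2 s) (hg4 : ContDiffOn ℝ 2 g4 s)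
    (hA : ContDiffOn ℝ 3 A s) (hB : ContDiffOn ℝ 3 B s)
    (odeA : ∀ x ∈ s,
      g4 x * deriv (deriv A) x - deriv g4 x * deriv A x
        + (g2 x * deriv g4 x - deriv g2 x * g4 x + 4 * g0 x * g4 x ^ 2
            - g2 x ^ 2 * g4 x) * A x = 0)
    (odeB : ∀ x ∈ s,
      g4 x * deriv (deriv B) x - deriv g4 x * deriv B x
        + (g2 x * deriv g4 x - deriv g2 x * g4 x + 4 * g0 x * g4 x ^ 2
            - g2 x ^ 2 * g4 x) * B x = 0) {x : ℝ} (hx : x ∈ s) :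
    ThirdOrderEq g0 g2 g4 (fun t => A t * B t) x := by
  have hA1 : ContDiffOn ℝ 2 (deriv A) s := hA.deriv_of_isOpen hs (by norm_num)
  have hA2 : ContDiffOn ℝ 1 (deriv (deriv A)) s := hA1.deriv_of_isOpen hs (by norm_num)
  have hB1 : ContDiffOn ℝ 2 (deriv B) s := hB.deriv_of_isOpen hs (by norm_num)
  have hB2 : ContDiffOn ℝ 1 (deriv (deriv B)) s := hB1.deriv_of_isOpen hs (by norm_num)
  have dA {y} (hy : y ∈ s) := hasDerivAt_deriv_of_contDiffOn hs hA (by norm_num) hy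
  have dA1 {y} (hy : y ∈ s) := hasDerivAt_deriv_of_contDiffOn hs hA1 (by norm_num) hy
  have dA2 {y} (hy : y ∈ s) := hasDerivAt_deriv_of_contDiffOn hs hA2 (by norm_num) hy
  have dB {y} (hy : y ∈ s) := hasDerivAt_deriv_of_contDiffOn hs hB (by norm_num) hy
  have dB1 {y} (hy : y ∈ s) := hasDerivAt_deriv_of_contDiffOn hs hB1 (by norm_num) hy
  have dB2 {y} (hy : y ∈ s) := hasDerivAt_deriv_of_contDiffOn hs hB2 (by norm_num) hy
  have h1 : ∀ y ∈ s, deriv (fun t => A t * B t) y = deriv A y * B y + A y * deriv B y :=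
    fun y hy => ((dA hy).mul (dB hy)).deriv
  have h2 : ∀ y ∈ s, deriv (deriv (fun t => A t * B t)) y =
      (deriv (deriv A) y * B y + deriv A y * deriv B y)
        + (deriv A y * deriv B y + A y * deriv (deriv B) y) := fun y hy =>
    ((((dA1 hy).mul (dB hy)).add ((dA hy).mul (dB1 hy))).congr_of_eventuallyEq
      (Filter.eventually_of_mem (hs.mem_nhds hy) h1)).deriv
  have h3 : deriv (deriv (deriv (fun t => A t * B t))) x =
      ((deriv (deriv (deriv A)) x * B x + deriv (deriv A) x * deriv B x)
        + (deriv (deriv A) x * deriv B x + deriv A x * deriv (deriv B) x))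
      + ((deriv (deriv A) x * deriv B x + deriv A x * deriv (deriv B) x)
        + (deriv A x * deriv (deriv B) x + A x * deriv (deriv (deriv B)) x)) :=
    (((((dA2 hx).mul (dB hx)).add ((dA1 hx).mul (dB1 hx))).add
      (((dA1 hx).mul (dB1 hx)).add ((dA hx).mul (dB2 hx)))).congr_of_eventuallyEq
      (Filter.eventually_of_mem (hs.mem_nhds hx) h2)).deriv
  have dodeA := deriv_secondOrderEq hs hg0 hg2 hg4 hA odeA hx
  have dodeB := deriv_secondOrderEq hs hg0 hg2 hg4 hB odeB hx
  unfold ThirdOrderEq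
  rw [h3, h2 x hx, h1 x hx]
  linear_combination g4 x * B x * dodeA + g4 x * A x * dodeB
    + (3 * g4 x * deriv B x - 3 * deriv g4 x * B x) * odeA x hx
    + (3 * g4 x * deriv A x - 3 * deriv g4 x * A x) * odeB x hx

/-- If `A` and `B` solve the second-order linear ODE
`g4 w'' - g4' w' + (g2 g4' - g2' g4 + 4 g0 g4² - g2² g4) w = 0` on an open interval
where `g4` does not vanish, then the product `A·B` solves the third-order linear ODE
of Example 1; in particular `A²`, `A·B` and `B²` are solutions of that equation. -/
theorem stmt_2 (g0 g2 g4 A B : ℝ → ℝ) (a b : ℝ) (hab : a < b)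
    (hg0 : ContDiffOn ℝ (⊤ : ℕ∞) g0 (Set.Ioo a b))
    (hg2 : ContDiffOn ℝ (⊤ : ℕ∞) g2 (Set.Ioo a b))
    (hg4 : ContDiffOn ℝ (⊤ : ℕ∞) g4 (Set.Ioo a b))
    (hg4ne : ∀ x ∈ Set.Ioo a b, g4 x ≠ 0)
    (hA : ContDiffOn ℝ 3 A (Set.Ioo a b))
    (hB : ContDiffOn ℝ 3 B (Set.Ioo a b))
    (odeA : ∀ x ∈ Set.Ioo a b,
      g4 x * deriv (deriv A) x - deriv g4 x * deriv A x
        + (g2 x * deriv g4 x - deriv g2 x * g4 x + 4 * g0 x * g4 x ^ 2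
            - g2 x ^ 2 * g4 x) * A x = 0)
    (odeB : ∀ x ∈ Set.Ioo a b,
      g4 x * deriv (deriv B) x - deriv g4 x * deriv B x
        + (g2 x * deriv g4 x - deriv g2 x * g4 x + 4 * g0 x * g4 x ^ 2
            - g2 x ^ 2 * g4 x) * B x = 0) :
    (∀ x ∈ Set.Ioo a b, ThirdOrderEq g0 g2 g4 (fun s => A s * B s) x) ∧
    (∀ x ∈ Set.Ioo a b, ThirdOrderEq g0 g2 g4 (fun s => A s * A s) x) ∧
    (∀ x ∈ Set.Ioo a b, ThirdOrderEq g0 g2 g4 (fun s => B s * B s) x) := by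
  have hg0' : ContDiffOn ℝ 1 g0 (Set.Ioo a b) := by exact_mod_cast contDiffOn_infty.mp hg0 1
  have hg2' : ContDiffOn ℝ 2 g2 (Set.Ioo a b) := by exact_mod_cast contDiffOn_infty.mp hg2 2
  have hg4' : ContDiffOn ℝ 2 g4 (Set.Ioo a b) := by exact_mod_cast contDiffOn_infty.mp hg4 2
  exact ⟨fun x hx => thirdOrderEq_mul isOpen_Ioo hg0' hg2' hg4' hA hB odeA odeB hx,
    fun x hx => thirdOrderEq_mul isOpen_Ioo hg0' hg2' hg4' hA hA odeA odeA hx,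
    fun x hx => thirdOrderEq_mul isOpen_Ioo hg0' hg2' hg4' hB hB odeB odeB hx⟩
end

section
/- Let g2, g4, g6 : ℝ → ℝ be sufficiently smooth functions with g6 nonvanishing on an open interval, and define g0(x) = g2(x)g4(x)/(3g6(x)) - (2/27)g4(x)³/g6(x)² + (1/6)(g4(x)/g6(x))'. Consider the planar differential system ẋ = -y, ẏ = g0(x) + g2(x)y² + g4(x)y⁴ + g6(x)y⁶. Suppose h̃2 is a C¹ solution of the first-order linear differential equation 9g6(x)h̃2'(x) + 4(g4(x)² - 3g2(x)g6(x))h̃2(x) = 0, and define h̃0(x) = g4(x)h̃2(x)/(3g6(x)). Then V(x,y) = (h̃0(x) + h̃2(x)y²)³ satisfies the inverse integrating factor equation P ∂V/∂x + Q ∂V/∂y = (∂P/∂x + ∂Q/∂y)·V for this system. -/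
/-- with `g0 = g2 g4/(3 g6) - (2/27) g4³/g6² + (1/6)(g4/g6)'`, if `h̃2`
solves `9 g6 h̃2' + 4(g4² - 3 g2 g6) h̃2 = 0` and `h̃0 = g4 h̃2/(3 g6)`, then
`V(x,y) = (h̃0(x) + h̃2(x) y²)³` satisfies the inverse integrating factor equation
for the system `ẋ = -y`, `ẏ = g0(x) + g2(x) y² + g4(x) y⁴ + g6(x) y⁶`. -/
theorem stmt_5 (g0 g2 g4 g6 h2 h0 : ℝ → ℝ) (a b : ℝ) (hab : a < b)
    (hg2 : ContDiffOn ℝ (⊤ : ℕ∞) g2 (Set.Ioo a b))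
    (hg4 : ContDiffOn ℝ (⊤ : ℕ∞) g4 (Set.Ioo a b))
    (hg6 : ContDiffOn ℝ (⊤ : ℕ∞) g6 (Set.Ioo a b))
    (hg6ne : ∀ x ∈ Set.Ioo a b, g6 x ≠ 0)
    (hg0 : ∀ x ∈ Set.Ioo a b,
      g0 x = g2 x * g4 x / (3 * g6 x) - 2 / 27 * g4 x ^ 3 / g6 x ^ 2
        + 1 / 6 * deriv (fun s => g4 s / g6 s) x)
    (hh2 : ContDiffOn ℝ 1 h2 (Set.Ioo a b))
    (ode : ∀ x ∈ Set.Ioo a b,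
      9 * g6 x * deriv h2 x + 4 * (g4 x ^ 2 - 3 * g2 x * g6 x) * h2 x = 0)
    (hh0 : ∀ x ∈ Set.Ioo a b, h0 x = g4 x * h2 x / (3 * g6 x)) :
    ∀ x ∈ Set.Ioo a b, ∀ y : ℝ,
      (-y) * deriv (fun s => (h0 s + h2 s * y ^ 2) ^ 3) x
        + (g0 x + g2 x * y ^ 2 + g4 x * y ^ 4 + g6 x * y ^ 6)
            * deriv (fun t => (h0 x + h2 x * t ^ 2) ^ 3) y
      = (deriv (fun _ : ℝ => -y) x
          + deriv (fun t => g0 x + g2 x * t ^ 2 + g4 x * t ^ 4 + g6 x * t ^ 6) y)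
        * (h0 x + h2 x * y ^ 2) ^ 3 := by
  intro x hx y
  have hnhds : Set.Ioo a b ∈ nhds x := isOpen_Ioo.mem_nhds hx
  have hne := hg6ne x hx
  have dg4 : DifferentiableAt ℝ g4 x := (hg4.contDiffAt hnhds).differentiableAt (by simp)
  have dg6 : DifferentiableAt ℝ g6 x := (hg6.contDiffAt hnhds).differentiableAt (by simp)
  have dh2 : HasDerivAt h2 (deriv h2 x) x :=
    ((hh2.contDiffAt hnhds).differentiableAt (by simp)).hasDerivAt
  have dr : HasDerivAt (fun s => g4 s / g6 s) (deriv (fun s => g4 s / g6 s) x) x :=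
    (dg4.fun_div dg6 hne).hasDerivAt
  have hg0x := hg0 x hx
  have hodex := ode x hx
  have hh0x := hh0 x hx
  generalize deriv (fun s => g4 s / g6 s) x = r' at dr hg0x
  generalize deriv h2 x = d at dh2 hodex
  have dh0 : HasDerivAt h0 ((r' * h2 x + g4 x / g6 x * d) / 3) x := by
    refine ((dr.mul dh2).div_const 3).congr_of_eventuallyEq ?_
    filter_upwards [hnhds] with s hs
    have := hg6ne s hs
    rw [hh0 s hs]
    simp only [Pi.mul_apply]
    field_simp
  have dVx := ((dh0.fun_add (dh2.mul_const (y ^ 2))).fun_pow 3).deriv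
  have dpow (n : ℕ) (c : ℝ) : HasDerivAt (fun t : ℝ => c * t ^ n) (c * (n * y ^ (n - 1))) y :=
    (hasDerivAt_pow n y).const_mul c
  have dVy := (((dpow 2 (h2 x)).const_add (h0 x)).fun_pow 3).deriv
  have dQ := ((((dpow 2 (g2 x)).const_add (g0 x)).fun_add (dpow 4 (g4 x))).fun_add
    (dpow 6 (g6 x))).deriv
  have hd : d = 4 / 3 * h2 x * g2 x - 4 / 9 * g4 x ^ 2 * h2 x / g6 x := by
    field_simp
    linarith
  rw [dVx, dVy, dQ, deriv_const, hh0x, hg0x, hd]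
  push_cast
  field_simp
  ring
end

section
/- Let g2, g4, g6 : ℝ → ℝ be sufficiently smooth with g6 nonvanishing, define g0(x) = g2(x)g4(x)/(3g6(x)) - (2/27)g4(x)³/g6(x)² + (1/6)(g4(x)/g6(x))', and consider the system ẋ = -y, ẏ = g0(x) + g2(x)y² + g4(x)y⁴ + g6(x)y⁶. Let h̃2 be a nonvanishing C¹ solution of 9g6 h̃2' + 4(g4² - 3g2g6)h̃2 = 0 and set h̃0 = g4h̃2/(3g6). If (x(t), y(t)) is a differentiable solution of the system, then the function z(t) = h̃0(x(t)) + h̃2(x(t))y(t)² satisfies z'(t) = (2/9)·z(t)·(-3g2(x(t)) + g4(x(t))²/g6(x(t)) - 9g6(x(t))z(t)²/h̃2(x(t))²)·x'(t); that is, along orbits z as a function of x satisfies the Bernoulli equation dz/dx = (2/9)z(-3g2 + g4²/g6 - 9g6 z²/h̃2²). -/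
/-- with `g0`, `h̃2`, `h̃0` as in Example 2, along a solution
`(x(t), y(t))` of the system, the function `z = h̃0(x) + h̃2(x) y²` satisfies
`z' = (2/9) z (-3 g2 + g4²/g6 - 9 g6 z²/h̃2²) x'`, i.e. along orbits it satisfies a
Bernoulli equation. -/
theorem stmt_6 (g0 g2 g4 g6 h2 h0 x y : ℝ → ℝ)
    (hg2 : ContDiff ℝ (⊤ : ℕ∞) g2) (hg4 : ContDiff ℝ (⊤ : ℕ∞) g4) (hg6 : ContDiff ℝ (⊤ : ℕ∞) g6)
    (hg6ne : ∀ s, g6 s ≠ 0)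
    (hg0 : ∀ s, g0 s = g2 s * g4 s / (3 * g6 s) - 2 / 27 * g4 s ^ 3 / g6 s ^ 2
        + 1 / 6 * deriv (fun r => g4 r / g6 r) s)
    (hh2 : ContDiff ℝ 1 h2) (hh2ne : ∀ s, h2 s ≠ 0)
    (ode : ∀ s, 9 * g6 s * deriv h2 s + 4 * (g4 s ^ 2 - 3 * g2 s * g6 s) * h2 s = 0)
    (hh0 : ∀ s, h0 s = g4 s * h2 s / (3 * g6 s))
    (hx : Differentiable ℝ x) (hy : Differentiable ℝ y)
    (hx' : ∀ t, deriv x t = -(y t))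
    (hy' : ∀ t, deriv y t = g0 (x t) + g2 (x t) * y t ^ 2 + g4 (x t) * y t ^ 4
        + g6 (x t) * y t ^ 6) :
    ∀ t, deriv (fun r => h0 (x r) + h2 (x r) * y r ^ 2) t
      = 2 / 9 * (h0 (x t) + h2 (x t) * y t ^ 2)
          * (-3 * g2 (x t) + g4 (x t) ^ 2 / g6 (x t)
              - 9 * g6 (x t) * (h0 (x t) + h2 (x t) * y t ^ 2) ^ 2 / h2 (x t) ^ 2)
          * deriv x t := by
  intro t
  have hw : HasDerivAt (fun r => g4 r / g6 r) (deriv (fun r => g4 r / g6 r) (x t)) (x t) :=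
    (((hg4.differentiable (by simp)) _).div ((hg6.differentiable (by simp)) _)
      (hg6ne _)).hasDerivAt
  have hh : HasDerivAt h2 (deriv h2 (x t)) (x t) :=
    ((hh2.differentiable (by simp)) _).hasDerivAt
  have hz : (fun r => h0 (x r) + h2 (x r) * y r ^ 2)
      = fun r => h2 (x r) * (g4 (x r) / g6 (x r) / 3 + y r ^ 2) := by
    funext r
    rw [hh0]
    have := hg6ne (x r)
    field_simp
  have hd : HasDerivAt (fun r => h2 (x r) * (g4 (x r) / g6 (x r) / 3 + y r ^ 2)) _ t :=
    (hh.comp t (hx t).hasDerivAt).mul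
      (((hw.comp t (hx t).hasDerivAt).div_const 3).add ((hy t).hasDerivAt.pow 2))
  have hh2' : deriv h2 (x t)
      = -(4 * (g4 (x t) ^ 2 - 3 * g2 (x t) * g6 (x t)) * h2 (x t)) / (9 * g6 (x t)) := by
    rw [eq_div_iff (mul_ne_zero (by norm_num) (hg6ne _))]
    linear_combination ode (x t)
  rw [hz, hd.deriv, hy', hx', hg0, hh0, hh2']
  generalize deriv (fun r => g4 r / g6 r) (x t) = w
  have h6 := hg6ne (x t)
  have h2ne := hh2ne (x t)
  simp only [Function.comp_apply]
  field_simp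
  ring
end

section
/- Let ρ be a real number and consider the planar polynomial differential system ẋ = y(-1 + 2ρ²(x² - y²)), ẏ = x + ρx² + ρy² + 4ρ²xy². Then the polynomial function V(x,y) = (x² + y²)²(1 + 2ρx + ρ²(x² + y²)) satisfies the inverse integrating factor equation P ∂V/∂x + Q ∂V/∂y = (∂P/∂x + ∂Q/∂y)·V for this system. -/
/-- the polynomial `V(x,y) = (x² + y²)² (1 + 2ρx + ρ²(x² + y²))`
satisfies the inverse integrating factor equation for the system
`ẋ = y(-1 + 2ρ²(x² - y²))`, `ẏ = x + ρx² + ρy² + 4ρ²xy²`. -/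
theorem stmt_7 (ρ : ℝ) :
    ∀ x y : ℝ,
      (y * (-1 + 2 * ρ ^ 2 * (x ^ 2 - y ^ 2)))
          * deriv (fun s =>
              (s ^ 2 + y ^ 2) ^ 2 * (1 + 2 * ρ * s + ρ ^ 2 * (s ^ 2 + y ^ 2))) x
        + (x + ρ * x ^ 2 + ρ * y ^ 2 + 4 * ρ ^ 2 * x * y ^ 2)
          * deriv (fun t =>
              (x ^ 2 + t ^ 2) ^ 2 * (1 + 2 * ρ * x + ρ ^ 2 * (x ^ 2 + t ^ 2))) y
      = (deriv (fun s => y * (-1 + 2 * ρ ^ 2 * (s ^ 2 - y ^ 2))) x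
          + deriv (fun t => x + ρ * x ^ 2 + ρ * t ^ 2 + 4 * ρ ^ 2 * x * t ^ 2) y)
        * ((x ^ 2 + y ^ 2) ^ 2 * (1 + 2 * ρ * x + ρ ^ 2 * (x ^ 2 + y ^ 2))) := by
  intro x y
  have hsq (a : ℝ) : HasDerivAt (fun s : ℝ => s ^ 2) (2 * a) a := by
    simpa using hasDerivAt_pow 2 a
  have hVx := (((hsq x).add_const (y ^ 2)).pow 2).mul
    ((((hasDerivAt_id x).const_mul (2 * ρ)).const_add 1).add
      (((hsq x).add_const (y ^ 2)).const_mul (ρ ^ 2)))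
  have hVy := (((hsq y).const_add (x ^ 2)).pow 2).mul
    ((((hsq y).const_add (x ^ 2)).const_mul (ρ ^ 2)).const_add (1 + 2 * ρ * x))
  have hPx := ((((hsq x).sub_const (y ^ 2)).const_mul (2 * ρ ^ 2)).const_add (-1)).const_mul y
  have hQy := (((hsq y).const_mul ρ).const_add (x + ρ * x ^ 2)).add
    ((hsq y).const_mul (4 * ρ ^ 2 * x))
  erw [hVx.deriv, hVy.deriv, hPx.deriv, hQy.deriv]
  simp
  ring
end

section
/- Let k1, k2, k3, k4, k5 be real constants and c : ℝ → ℝ a C¹ function. Consider the planar differential system ẋ = c(x) + y + (k1 + k2 c(x))y², ẏ = c'(x)(k3 + k4 y + k5 y²). Suppose V0 : ℝ → ℝ is a C¹ function satisfying the linear differential equation (k3 + k4 y + k5 y²)V0'(y) = (1 + k4 + 2k5 y + k2 y²)V0(y). Then V(x,y) = V0(y) satisfies the inverse integrating factor equation P ∂V/∂x + Q ∂V/∂y = (∂P/∂x + ∂Q/∂y)·V for this system. -/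
/-- if `V0` solves `(k3 + k4 y + k5 y²) V0' = (1 + k4 + 2 k5 y + k2 y²) V0`,
then `V(x,y) = V0(y)` satisfies the inverse integrating factor equation for the system
`ẋ = c(x) + y + (k1 + k2 c(x)) y²`, `ẏ = c'(x)(k3 + k4 y + k5 y²)`. -/
theorem stmt_10 (k1 k2 k3 k4 k5 : ℝ) (c V0 : ℝ → ℝ)
    (hc : ContDiff ℝ 1 c) (hV0 : ContDiff ℝ 1 V0)
    (ode : ∀ y, (k3 + k4 * y + k5 * y ^ 2) * deriv V0 y
      = (1 + k4 + 2 * k5 * y + k2 * y ^ 2) * V0 y) :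
    ∀ x y : ℝ,
      (c x + y + (k1 + k2 * c x) * y ^ 2) * deriv (fun _ : ℝ => V0 y) x
        + (deriv c x * (k3 + k4 * y + k5 * y ^ 2)) * deriv V0 y
      = (deriv (fun s => c s + y + (k1 + k2 * c s) * y ^ 2) x
          + deriv (fun t => deriv c x * (k3 + k4 * t + k5 * t ^ 2)) y)
        * V0 y := by
  intro x y
  have hcx : HasDerivAt c (deriv c x) x :=
    (hc.differentiable one_ne_zero x).hasDerivAt
  have hP : HasDerivAt (fun s => c s + y + (k1 + k2 * c s) * y ^ 2)
      (deriv c x + k2 * deriv c x * y ^ 2) x :=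
    (hcx.add_const y).add (((hcx.const_mul k2).const_add k1).mul_const (y ^ 2))
  have hQ : HasDerivAt (fun t => deriv c x * (k3 + k4 * t + k5 * t ^ 2))
      (deriv c x * (k4 + 2 * k5 * y)) y := by
    have h := ((((hasDerivAt_id' y).const_mul k4).const_add k3).add
      (((hasDerivAt_id' y).pow 2).const_mul k5)).const_mul (deriv c x)
    refine h.congr_deriv ?_
    push_cast
    ring
  rw [hP.deriv, hQ.deriv, deriv_const]
  linear_combination deriv c x * ode y
end

section
/- Let k0, k1 be real constants with k1 ≠ 0, let g1, g2 : ℝ → ℝ and f1, f2, f3, f4 : ℝ → ℝ be C¹ functions. Consider the planar differential system ẋ = k0 g1(x)(g1(x)f1(y) + g2(x)f2(y)), ẏ = (k1 f3(y) + f4(y))(g1'(x)g2(x) - g1(x)g2'(x))/k1. Suppose h : ℝ → ℝ is a C¹ function satisfying the first-order linear differential equation (f3(y) + f4(y)/k1)h'(y) + (k0 f2(y) - f3'(y) - f4'(y)/k1)h(y) = 0. Then V(x,y) = g1(x)²·h(y) satisfies the inverse integrating factor equation P ∂V/∂x + Q ∂V/∂y = (∂P/∂x + ∂Q/∂y)·V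 for this system. -/
/-- if `h` solves `(f3 + f4/k1) h' + (k0 f2 - f3' - f4'/k1) h = 0`,
then `V(x,y) = g1(x)² h(y)` satisfies the inverse integrating factor equation for the
system `ẋ = k0 g1(x)(g1(x) f1(y) + g2(x) f2(y))`,
`ẏ = (k1 f3(y) + f4(y))(g1'(x) g2(x) - g1(x) g2'(x))/k1`. -/
theorem stmt_11 (k0 k1 : ℝ) (hk1 : k1 ≠ 0) (g1 g2 f1 f2 f3 f4 h : ℝ → ℝ)
    (hg1 : ContDiff ℝ 1 g1) (hg2 : ContDiff ℝ 1 g2)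
    (hf1 : ContDiff ℝ 1 f1) (hf2 : ContDiff ℝ 1 f2)
    (hf3 : ContDiff ℝ 1 f3) (hf4 : ContDiff ℝ 1 f4)
    (hh : ContDiff ℝ 1 h)
    (ode : ∀ y, (f3 y + f4 y / k1) * deriv h y
      + (k0 * f2 y - deriv f3 y - deriv f4 y / k1) * h y = 0) :
    ∀ x y : ℝ,
      (k0 * g1 x * (g1 x * f1 y + g2 x * f2 y))
          * deriv (fun s => g1 s ^ 2 * h y) x
        + ((k1 * f3 y + f4 y) * (deriv g1 x * g2 x - g1 x * deriv g2 x) / k1)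
          * deriv (fun t => g1 x ^ 2 * h t) y
      = (deriv (fun s => k0 * g1 s * (g1 s * f1 y + g2 s * f2 y)) x
          + deriv (fun t =>
              (k1 * f3 t + f4 t) * (deriv g1 x * g2 x - g1 x * deriv g2 x) / k1) y)
        * (g1 x ^ 2 * h y) := by
  intro x y
  have d1 := (hg1.differentiable one_ne_zero x).hasDerivAt
  have d2 := (hg2.differentiable one_ne_zero x).hasDerivAt
  have d3 := (hf3.differentiable one_ne_zero y).hasDerivAt
  have d4 := (hf4.differentiable one_ne_zero y).hasDerivAt
  have dh := (hh.differentiable one_ne_zero y).hasDerivAt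
  have hVx : deriv (fun s => g1 s ^ 2 * h y) x = 2 * g1 x * deriv g1 x * h y := by
    simpa using ((d1.fun_pow 2).mul_const (h y)).deriv
  have hVy : deriv (fun t => g1 x ^ 2 * h t) y = g1 x ^ 2 * deriv h y :=
    (dh.const_mul (g1 x ^ 2)).deriv
  have hPx : deriv (fun s => k0 * g1 s * (g1 s * f1 y + g2 s * f2 y)) x
      = k0 * deriv g1 x * (g1 x * f1 y + g2 x * f2 y)
        + k0 * g1 x * (deriv g1 x * f1 y + deriv g2 x * f2 y) :=
    ((d1.const_mul k0).fun_mul ((d1.mul_const (f1 y)).fun_add (d2.mul_const (f2 y)))).deriv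
  have hQy : deriv (fun t =>
        (k1 * f3 t + f4 t) * (deriv g1 x * g2 x - g1 x * deriv g2 x) / k1) y
      = (k1 * deriv f3 y + deriv f4 y) * (deriv g1 x * g2 x - g1 x * deriv g2 x) / k1 :=
    ((((d3.const_mul k1).fun_add d4).mul_const _).div_const k1).deriv
  rw [hVx, hVy, hPx, hQy]
  have e := ode y
  field_simp at e ⊢
  linear_combination g1 x ^ 2 * (deriv g1 x * g2 x - g1 x * deriv g2 x) * e
end

section
/- Let a0, a2, b0, b1, b2 be real numbers with a2 ≠ 0 and consider the quadratic planar differential system ẋ = (a0 + x)(y - a2 x), ẏ = b0 + b1 x + b2 x² + a2(a0 + x)y. Then on the open half-plane {(x,y) : x > -a0}, the function V_α(x,y) = exp{(y² - 2a2 xy - b2 x² + 2(a0 b2 - b1)x)/a2²}·(a0 + x)^{(-a2² - 2b0 + 2a0 b1 - 2a0² b2)/a2²} satisfies the partial differential equation P ∂V_α/∂x + Q ∂V_α/∂y = α(∂P/∂x + ∂Q/∂y)·V_α with α = -1; equivalently, 1/V_α is an inverse integrating factor of the system on this domain. -/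
/-- The function `V_α` of Example 9. -/
noncomputable def VaHermite (a0 a2 b0 b1 b2 x y : ℝ) : ℝ :=
  Real.exp ((y ^ 2 - 2 * a2 * x * y - b2 * x ^ 2 + 2 * (a0 * b2 - b1) * x) / a2 ^ 2)
    * (a0 + x) ^ ((-a2 ^ 2 - 2 * b0 + 2 * a0 * b1 - 2 * a0 ^ 2 * b2) / a2 ^ 2)

theorem VaHermite_pos (a0 a2 b0 b1 b2 : ℝ) {x : ℝ} (y : ℝ) (hx : -a0 < x) :
    0 < VaHermite a0 a2 b0 b1 b2 x y :=
  mul_pos (Real.exp_pos _) (Real.rpow_pos_of_pos (by linarith) _)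

theorem hasDerivAt_VaHermite_fst (a0 a2 b0 b1 b2 : ℝ) {x : ℝ} (y : ℝ) (hx : -a0 < x) :
    HasDerivAt (fun s => VaHermite a0 a2 b0 b1 b2 s y)
      (((-2 * a2 * y - 2 * b2 * x + 2 * (a0 * b2 - b1)) / a2 ^ 2
          + (-a2 ^ 2 - 2 * b0 + 2 * a0 * b1 - 2 * a0 ^ 2 * b2) / a2 ^ 2 / (a0 + x))
        * VaHermite a0 a2 b0 b1 b2 x y) x := by
  have hpos : 0 < a0 + x := by linarith
  have hid := hasDerivAt_id' x
  have hexp := ((((((hid.const_mul (2 * a2)).mul_const y).const_sub (y ^ 2)).sub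
    ((hid.pow 2).const_mul b2)).add
    (hid.const_mul (2 * (a0 * b2 - b1)))).div_const (a2 ^ 2)).exp
  have hpow := (hid.const_add a0).rpow_const
    (p := (-a2 ^ 2 - 2 * b0 + 2 * a0 * b1 - 2 * a0 ^ 2 * b2) / a2 ^ 2) (Or.inl hpos.ne')
  refine (hexp.mul hpow).congr_deriv ?_
  rw [Real.rpow_sub_one hpos.ne']
  simp only [VaHermite, Pi.pow_apply, Pi.sub_apply, Pi.add_apply]
  push_cast
  ring

theorem hasDerivAt_VaHermite_snd (a0 a2 b0 b1 b2 x y : ℝ) :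
    HasDerivAt (fun t => VaHermite a0 a2 b0 b1 b2 x t)
      ((2 * y - 2 * a2 * x) / a2 ^ 2 * VaHermite a0 a2 b0 b1 b2 x y) y := by
  have hid := hasDerivAt_id' y
  have hexp := (((((hid.pow 2).sub (hid.const_mul (2 * a2 * x))).sub_const
    (b2 * x ^ 2)).add_const (2 * (a0 * b2 - b1) * x)).div_const (a2 ^ 2)).exp
  refine (hexp.mul_const
    ((a0 + x) ^ ((-a2 ^ 2 - 2 * b0 + 2 * a0 * b1 - 2 * a0 ^ 2 * b2) / a2 ^ 2))).congr_deriv ?_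
  simp only [VaHermite, Pi.pow_apply, Pi.sub_apply]
  push_cast
  ring

/-- on the half-plane `x > -a0`, the function `V_α` of Example 9
satisfies `P ∂V_α/∂x + Q ∂V_α/∂y = α (div) V_α` with `α = -1` for the quadratic system
`ẋ = (a0 + x)(y - a2 x)`, `ẏ = b0 + b1 x + b2 x² + a2 (a0 + x) y`; equivalently,
`1/V_α` is an inverse integrating factor of the system on this domain. -/
theorem stmt_12 (a0 a2 b0 b1 b2 : ℝ) (ha2 : a2 ≠ 0) :
    ∀ x y : ℝ, -a0 < x →
      (((a0 + x) * (y - a2 * x)) * deriv (fun s => VaHermite a0 a2 b0 b1 b2 s y) x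
          + (b0 + b1 * x + b2 * x ^ 2 + a2 * (a0 + x) * y)
              * deriv (fun t => VaHermite a0 a2 b0 b1 b2 x t) y
        = (-1) * (deriv (fun s => (a0 + s) * (y - a2 * s)) x
            + deriv (fun t => b0 + b1 * x + b2 * x ^ 2 + a2 * (a0 + x) * t) y)
          * VaHermite a0 a2 b0 b1 b2 x y)
      ∧
      (((a0 + x) * (y - a2 * x))
            * deriv (fun s => (VaHermite a0 a2 b0 b1 b2 s y)⁻¹) x
          + (b0 + b1 * x + b2 * x ^ 2 + a2 * (a0 + x) * y)
              * deriv (fun t => (VaHermite a0 a2 b0 b1 b2 x t)⁻¹) y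
        = (deriv (fun s => (a0 + s) * (y - a2 * s)) x
            + deriv (fun t => b0 + b1 * x + b2 * x ^ 2 + a2 * (a0 + x) * t) y)
          * (VaHermite a0 a2 b0 b1 b2 x y)⁻¹) := by
  intro x y hx
  have hne : a0 + x ≠ 0 := by linarith
  have hV := (VaHermite_pos a0 a2 b0 b1 b2 y hx).ne'
  have hVx := hasDerivAt_VaHermite_fst a0 a2 b0 b1 b2 y hx
  have hVy := hasDerivAt_VaHermite_snd a0 a2 b0 b1 b2 x y
  have hP : HasDerivAt (fun s => (a0 + s) * (y - a2 * s))
      (1 * (y - a2 * x) + (a0 + x) * -(a2 * 1)) x :=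
    ((hasDerivAt_id' x).const_add a0).mul (((hasDerivAt_id' x).const_mul a2).const_sub y)
  have hQ : HasDerivAt (fun t => b0 + b1 * x + b2 * x ^ 2 + a2 * (a0 + x) * t)
      (a2 * (a0 + x) * 1) y :=
    ((hasDerivAt_id' y).const_mul (a2 * (a0 + x))).const_add _
  rw [hVx.deriv, hVy.deriv, hP.deriv, hQ.deriv, (hVx.fun_inv hV).deriv, (hVy.fun_inv hV).deriv]
  generalize VaHermite a0 a2 b0 b1 b2 x y = V at hV
  constructor <;> field_simp <;> ring
end

section
/- Consider the planar polynomial differential system ẋ = 1 - x², ẏ = y(x - y). Then on the open set {(x,y) : |x| < 1, 1 - 2xy + y² > 0, 1 - xy ≠ 0}, the function V_α(x,y) = (1 - x²)^{-1/4}·(1 - xy)/(1 - 2xy + y²) satisfies the partial differential equation P ∂V_α/∂x + Q ∂V_α/∂y = α(∂P/∂x + ∂Q/∂y)·V_α with α = -1/2; equivalently, V = V_α^{-2} is an inverse integrating factor of the system on this domain. -/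
/-- The function `V_α` of Example 10. -/
noncomputable def VaChebyshev (x y : ℝ) : ℝ :=
  (1 - x ^ 2) ^ (-(1 / 4 : ℝ)) * (1 - x * y) / (1 - 2 * x * y + y ^ 2)

theorem hasDerivAt_VaChebyshev_left {x y : ℝ} (hx : 0 < 1 - x ^ 2)
    (hD : 1 - 2 * x * y + y ^ 2 ≠ 0) (hxy : 1 - x * y ≠ 0) :
    HasDerivAt (fun s => VaChebyshev s y)
      (VaChebyshev x y *
        (x / (2 * (1 - x ^ 2)) - y / (1 - x * y) + 2 * y / (1 - 2 * x * y + y ^ 2))) x := by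
  have hP : HasDerivAt (fun s : ℝ => 1 - s ^ 2) (-(2 * x)) x := by
    simpa using (hasDerivAt_pow 2 x).const_sub 1
  have hpow := hP.rpow_const (p := -(1 / 4 : ℝ)) (Or.inl hx.ne')
  have hN : HasDerivAt (fun s : ℝ => 1 - s * y) (-y) x := by
    simpa using ((hasDerivAt_id x).mul_const y).const_sub 1
  have hden : HasDerivAt (fun s : ℝ => 1 - 2 * s * y + y ^ 2) (-(2 * y)) x := by
    simpa using ((((hasDerivAt_id x).const_mul 2).mul_const y).const_sub 1).add_const (y ^ 2)
  refine ((hpow.fun_mul hN).fun_div hden hD).congr_deriv ?_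
  rw [Real.rpow_sub_one hx.ne', VaChebyshev]
  have := hx.ne'
  field_simp
  ring

theorem hasDerivAt_VaChebyshev_right {x y : ℝ}
    (hD : 1 - 2 * x * y + y ^ 2 ≠ 0) (hxy : 1 - x * y ≠ 0) :
    HasDerivAt (fun t => VaChebyshev x t)
      (VaChebyshev x y *
        (-x / (1 - x * y) - (2 * y - 2 * x) / (1 - 2 * x * y + y ^ 2))) y := by
  have hN : HasDerivAt (fun t : ℝ => 1 - x * t) (-x) y := by
    simpa using ((hasDerivAt_id y).const_mul x).const_sub 1
  have hden : HasDerivAt (fun t : ℝ => 1 - 2 * x * t + t ^ 2) (-(2 * x) + 2 * y) y := by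
    simpa using (((hasDerivAt_id y).const_mul (2 * x)).const_sub 1).fun_add (hasDerivAt_pow 2 y)
  refine ((hN.const_mul ((1 - x ^ 2) ^ (-(1 / 4 : ℝ)))).fun_div hden hD).congr_deriv ?_
  rw [VaChebyshev]
  generalize hE : 1 - 2 * x * y + y ^ 2 = E at hD ⊢
  field_simp
  rw [← hE]
  ring

theorem VaChebyshev_ne_zero {x y : ℝ} (hx : 0 < 1 - x ^ 2)
    (hD : 1 - 2 * x * y + y ^ 2 ≠ 0) (hxy : 1 - x * y ≠ 0) : VaChebyshev x y ≠ 0 :=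
  div_ne_zero (mul_ne_zero (Real.rpow_pos_of_pos hx _).ne' hxy) hD

/-- on `{|x| < 1, 1 - 2xy + y² > 0, 1 - xy ≠ 0}`, the function `V_α` of
Example 10 satisfies `P ∂V_α/∂x + Q ∂V_α/∂y = α (div) V_α` with `α = -1/2` for the
system `ẋ = 1 - x²`, `ẏ = y(x - y)`; equivalently, `V = V_α^{-2}` is an inverse
integrating factor of the system on this domain. -/
theorem stmt_13 :
    ∀ x y : ℝ, |x| < 1 → 1 - 2 * x * y + y ^ 2 > 0 → 1 - x * y ≠ 0 →
      ((1 - x ^ 2) * deriv (fun s => VaChebyshev s y) x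
          + (y * (x - y)) * deriv (fun t => VaChebyshev x t) y
        = (-(1 / 2)) * (deriv (fun s => 1 - s ^ 2) x
            + deriv (fun t => t * (x - t)) y) * VaChebyshev x y)
      ∧
      ((1 - x ^ 2) * deriv (fun s => ((VaChebyshev s y) ^ 2)⁻¹) x
          + (y * (x - y)) * deriv (fun t => ((VaChebyshev x t) ^ 2)⁻¹) y
        = (deriv (fun s => 1 - s ^ 2) x + deriv (fun t => t * (x - t)) y)
          * ((VaChebyshev x y) ^ 2)⁻¹) := by
  intro x y hx hD hxy
  have hP : 0 < 1 - x ^ 2 := sub_pos.2 ((sq_lt_one_iff_abs_lt_one x).2 hx)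
  have hV := VaChebyshev_ne_zero hP hD.ne' hxy
  have hVx := hasDerivAt_VaChebyshev_left hP hD.ne' hxy
  have hVy := hasDerivAt_VaChebyshev_right hD.ne' hxy
  have hPx : HasDerivAt (fun s : ℝ => 1 - s ^ 2) (-(2 * x)) x := by
    simpa using (hasDerivAt_pow 2 x).const_sub 1
  have hQy : HasDerivAt (fun t : ℝ => t * (x - t)) (x - y - y) y := by
    simpa [sub_eq_add_neg] using
      (hasDerivAt_id y).fun_mul ((hasDerivAt_id y).const_sub x)
  have hsum : (1 - x ^ 2) * (x / (2 * (1 - x ^ 2)) - y / (1 - x * y)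
        + 2 * y / (1 - 2 * x * y + y ^ 2))
      + y * (x - y) * (-x / (1 - x * y) - (2 * y - 2 * x) / (1 - 2 * x * y + y ^ 2))
      = x / 2 + y := by
    have hP0 := hP.ne'
    have hD0 := hD.ne'
    generalize hE : 1 - 2 * x * y + y ^ 2 = E at hD0 ⊢
    field_simp
    rw [← hE]
    ring
  rw [((hVx.fun_pow 2).fun_inv (pow_ne_zero 2 hV)).deriv,
    ((hVy.fun_pow 2).fun_inv (pow_ne_zero 2 hV)).deriv, hVx.deriv, hVy.deriv, hPx.deriv, hQy.deriv]
  generalize VaChebyshev x y = V at *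
  constructor
  · linear_combination V * hsum
  · rw [show (-(2 * x) + (x - y - y)) * (V ^ 2)⁻¹ = -2 * (x / 2 + y) * (V ^ 2)⁻¹ by ring, ← hsum]
    generalize x / (2 * (1 - x ^ 2)) - y / (1 - x * y) + 2 * y / (1 - 2 * x * y + y ^ 2) = A
    generalize -x / (1 - x * y) - (2 * y - 2 * x) / (1 - 2 * x * y + y ^ 2) = B
    field_simp
    ring
end

section
/- Consider the planar polynomial differential system ẋ = 1 - x², ẏ = 1 - xy. Then on the open set {(x,y) : 1 - 2xy + y² > 0}, the function V(x,y) = (1 - x²)²/√(1 - 2xy + y²) satisfies the inverse integrating factor equation P ∂V/∂x + Q ∂V/∂y = (∂P/∂x + ∂Q/∂y)·V for this system. -/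
/-- on `{1 - 2xy + y² > 0}`, the function
`V(x,y) = (1 - x²)²/√(1 - 2xy + y²)` satisfies the inverse integrating factor
equation for the system `ẋ = 1 - x²`, `ẏ = 1 - xy`. -/
theorem stmt_14 :
    ∀ x y : ℝ, 1 - 2 * x * y + y ^ 2 > 0 →
      (1 - x ^ 2)
          * deriv (fun s => (1 - s ^ 2) ^ 2 / Real.sqrt (1 - 2 * s * y + y ^ 2)) x
        + (1 - x * y)
          * deriv (fun t => (1 - x ^ 2) ^ 2 / Real.sqrt (1 - 2 * x * t + t ^ 2)) y
      = (deriv (fun s => 1 - s ^ 2) x + deriv (fun t => 1 - x * t) y)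
        * ((1 - x ^ 2) ^ 2 / Real.sqrt (1 - 2 * x * y + y ^ 2)) := by
  intro x y h
  have hs : 0 < Real.sqrt (1 - 2 * x * y + y ^ 2) := Real.sqrt_pos.2 h
  have hsq : Real.sqrt (1 - 2 * x * y + y ^ 2) ^ 2 = 1 - 2 * x * y + y ^ 2 := Real.sq_sqrt h.le
  have hDx : HasDerivAt (fun s : ℝ => 1 - 2 * s * y + y ^ 2) (-2 * y) x :=
    (((((hasDerivAt_id' x).const_mul 2).mul_const y).const_sub 1).add_const
      (y ^ 2)).congr_deriv (by ring)
  have hDy : HasDerivAt (fun t : ℝ => 1 - 2 * x * t + t ^ 2) (-2 * x + 2 * y) y :=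
    ((((hasDerivAt_id' y).const_mul (2 * x)).const_sub 1).fun_add
      ((hasDerivAt_id' y).fun_pow 2)).congr_deriv (by push_cast; ring)
  have hP : HasDerivAt (fun s : ℝ => 1 - s ^ 2) (-2 * x) x :=
    (((hasDerivAt_id' x).fun_pow 2).const_sub 1).congr_deriv (by push_cast; ring)
  have hQ : HasDerivAt (fun t : ℝ => 1 - x * t) (-x) y :=
    (((hasDerivAt_id' y).const_mul x).const_sub 1).congr_deriv (by ring)
  have hVx := (hP.fun_pow 2).fun_div (hDx.sqrt h.ne') hs.ne'
  have hVy := (hasDerivAt_const y ((1 - x ^ 2) ^ 2)).fun_div (hDy.sqrt h.ne') hs.ne'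
  rw [hVx.deriv, hVy.deriv, hP.deriv, hQ.deriv]
  generalize Real.sqrt (1 - 2 * x * y + y ^ 2) = r at hs hsq
  field_simp
  push_cast
  linear_combination (-x * (1 - x ^ 2) ^ 2) * hsq
end

section
/- Let a be a real parameter and consider the planar polynomial differential system ẋ = 1 + (2a² - 7)y² + 6y⁴ - 2axy(1 + y²) + 2x²y², ẏ = 2y²(1 - y²)(a - xy). Then on the open strip {(x,y) : |y| < 1}, the function V(x,y) = (1 - y²)^{-1/2}·exp{(2axy - (a² + x²)y²)/(1 - y²)} satisfies the inverse integrating factor equation P ∂V/∂x + Q ∂V/∂y = (∂P/∂x + ∂Q/∂y)·V for this system. -/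
/-- on the strip `|y| < 1`, the function
`V(x,y) = (1 - y²)^{-1/2} exp{(2axy - (a² + x²)y²)/(1 - y²)}` satisfies the inverse
integrating factor equation for the system of Example 12. -/
theorem stmt_15 (a : ℝ) :
    ∀ x y : ℝ, |y| < 1 →
      (1 + (2 * a ^ 2 - 7) * y ^ 2 + 6 * y ^ 4 - 2 * a * x * y * (1 + y ^ 2)
            + 2 * x ^ 2 * y ^ 2)
          * deriv (fun s => (1 - y ^ 2) ^ (-(1 / 2 : ℝ))
              * Real.exp ((2 * a * s * y - (a ^ 2 + s ^ 2) * y ^ 2) / (1 - y ^ 2))) x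
        + (2 * y ^ 2 * (1 - y ^ 2) * (a - x * y))
          * deriv (fun t => (1 - t ^ 2) ^ (-(1 / 2 : ℝ))
              * Real.exp ((2 * a * x * t - (a ^ 2 + x ^ 2) * t ^ 2) / (1 - t ^ 2))) y
      = (deriv (fun s => 1 + (2 * a ^ 2 - 7) * y ^ 2 + 6 * y ^ 4
              - 2 * a * s * y * (1 + y ^ 2) + 2 * s ^ 2 * y ^ 2) x
          + deriv (fun t => 2 * t ^ 2 * (1 - t ^ 2) * (a - x * t)) y)
        * ((1 - y ^ 2) ^ (-(1 / 2 : ℝ))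
            * Real.exp ((2 * a * x * y - (a ^ 2 + x ^ 2) * y ^ 2) / (1 - y ^ 2))) := by
  intro x y hy
  have hw : 0 < 1 - y ^ 2 := by
    have := (sq_lt_one_iff_abs_lt_one y).2 hy
    linarith
  have hVx : HasDerivAt (fun s => (1 - y ^ 2) ^ (-(1 / 2 : ℝ))
      * Real.exp ((2 * a * s * y - (a ^ 2 + s ^ 2) * y ^ 2) / (1 - y ^ 2))) _ x :=
    ((((((hasDerivAt_id' x).const_mul (2 * a)).mul_const y).sub
      ((((hasDerivAt_id' x).pow 2).const_add (a ^ 2)).mul_const (y ^ 2))).div_const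
        (1 - y ^ 2)).exp).const_mul ((1 - y ^ 2) ^ (-(1 / 2 : ℝ)))
  have hsub : HasDerivAt (fun t : ℝ => 1 - t ^ 2) _ y := ((hasDerivAt_id' y).pow 2).const_sub 1
  have hVy : HasDerivAt (fun t => (1 - t ^ 2) ^ (-(1 / 2 : ℝ))
      * Real.exp ((2 * a * x * t - (a ^ 2 + x ^ 2) * t ^ 2) / (1 - t ^ 2))) _ y :=
    (hsub.rpow_const (p := -(1 / 2 : ℝ)) (Or.inl hw.ne')).mul
      (((((hasDerivAt_id' y).const_mul (2 * a * x)).sub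
        (((hasDerivAt_id' y).pow 2).const_mul (a ^ 2 + x ^ 2))).div hsub hw.ne').exp)
  have hPx : HasDerivAt (fun s => 1 + (2 * a ^ 2 - 7) * y ^ 2 + 6 * y ^ 4
      - 2 * a * s * y * (1 + y ^ 2) + 2 * s ^ 2 * y ^ 2) _ x :=
    (((((hasDerivAt_id' x).const_mul (2 * a)).mul_const y).mul_const (1 + y ^ 2)).const_sub
      (1 + (2 * a ^ 2 - 7) * y ^ 2 + 6 * y ^ 4)).add
      ((((hasDerivAt_id' x).pow 2).const_mul 2).mul_const (y ^ 2))
  have hQy : HasDerivAt (fun t => 2 * t ^ 2 * (1 - t ^ 2) * (a - x * t)) _ y :=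
    ((((hasDerivAt_id' y).pow 2).const_mul 2).mul hsub).mul
      (((hasDerivAt_id' y).const_mul x).const_sub a)
  rw [hVx.deriv, hVy.deriv, hPx.deriv, hQy.deriv, Real.rpow_sub_one hw.ne']
  simp only [Pi.pow_apply, Pi.mul_apply, Pi.sub_apply, Pi.div_apply]
  generalize Real.exp _ = e
  generalize (1 - y ^ 2) ^ (-(1 / 2 : ℝ)) = r
  have hw' := hw.ne'
  field_simp
  ring
end

section
/- Let g0, g2, g4 : ℝ → ℝ be analytic with g4 nonvanishing, let A and B be two solutions of the second-order linear differential equation g4 w'' - g4' w' + (g2 g4' - g2' g4 + 4 g0 g4² - g2² g4) w = 0, and for a solution w of this equation define h̃0 = (g2 w - w')/(2g4) and V_w(x,y) = (h̃0(x) + w(x)y²)². Then the quotient H(x,y) = V_A(x,y)/V_B(x,y), defined where V_B ≠ 0, is a first integral of the system ẋ = -y, ẏ = g0(x) + g2(x)y² + g4(x)y⁴, i.e. it satisfies P ∂H/∂x + Q ∂H/∂y ≡ 0 there. -/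
/-- The constant term `h̃0 = (g2 w - w')/(2 g4)` attached to a solution `w` of the linear equation
satisfies `h̃0' = 2 g0 w - g2 h̃0`. -/
theorem hasDerivAt_constantTerm {g0 g2 g4 w : ℝ → ℝ} {x : ℝ}
    (hg2 : DifferentiableAt ℝ g2 x) (hg4 : DifferentiableAt ℝ g4 x) (hne : g4 x ≠ 0)
    (hw : ContDiff ℝ 2 w)
    (ode : g4 x * deriv (deriv w) x - deriv g4 x * deriv w x
        + (g2 x * deriv g4 x - deriv g2 x * g4 x + 4 * g0 x * g4 x ^ 2
            - g2 x ^ 2 * g4 x) * w x = 0) :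
    HasDerivAt (fun s => (g2 s * w s - deriv w s) / (2 * g4 s))
      (2 * g0 x * w x - g2 x * ((g2 x * w x - deriv w x) / (2 * g4 x))) x := by
  have hw1 : HasDerivAt w (deriv w x) x :=
    (hw.differentiable (by norm_num)).differentiableAt.hasDerivAt
  have hw2 : HasDerivAt (deriv w) (deriv (deriv w) x) x :=
    (hw.differentiable_deriv_two x).hasDerivAt
  refine (((hg2.hasDerivAt.fun_mul hw1).fun_sub hw2).fun_div (hg4.hasDerivAt.const_mul 2)
    (mul_ne_zero two_ne_zero hne)).congr_deriv ?_
  field_simp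
  linear_combination -ode

/-- The derivative of `h̃0(x) + w(x) y²` with respect to `x`. -/
theorem hasDerivAt_quadratic_left {g0 g2 g4 w : ℝ → ℝ} {x : ℝ} (y : ℝ)
    (hg2 : DifferentiableAt ℝ g2 x) (hg4 : DifferentiableAt ℝ g4 x) (hne : g4 x ≠ 0)
    (hw : ContDiff ℝ 2 w)
    (ode : g4 x * deriv (deriv w) x - deriv g4 x * deriv w x
        + (g2 x * deriv g4 x - deriv g2 x * g4 x + 4 * g0 x * g4 x ^ 2
            - g2 x ^ 2 * g4 x) * w x = 0) :
    HasDerivAt (fun s => (g2 s * w s - deriv w s) / (2 * g4 s) + w s * y ^ 2)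
      (2 * g0 x * w x - g2 x * ((g2 x * w x - deriv w x) / (2 * g4 x)) + deriv w x * y ^ 2) x :=
  (hasDerivAt_constantTerm hg2 hg4 hne hw ode).add
    ((hw.differentiable (by norm_num)).differentiableAt.hasDerivAt.mul_const _)

/-- The derivative of `h + w y²` with respect to `y`. -/
theorem hasDerivAt_quadratic_right (h w y : ℝ) :
    HasDerivAt (fun t : ℝ => h + w * t ^ 2) (2 * w * y) y := by
  refine (((hasDerivAt_pow 2 y).const_mul w).const_add h).congr_deriv ?_
  push_cast
  ring

/-- A quotient of squares of two functions with the same cofactor along a planar vector field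
`(p, q)` is annihilated by the field. -/
theorem mul_deriv_sq_div_sq_add_eq_zero {u v r s : ℝ → ℝ} {x y ux vx uy vy p q k : ℝ}
    (hu : HasDerivAt u ux x) (hv : HasDerivAt v vx x)
    (hr : HasDerivAt r uy y) (hs : HasDerivAt s vy y)
    (hur : u x = r y) (hvs : v x = s y) (hne : s y ≠ 0)
    (hU : p * ux + q * uy = k * r y) (hV : p * vx + q * vy = k * s y) :
    p * deriv (fun z => u z ^ 2 / v z ^ 2) x + q * deriv (fun z => r z ^ 2 / s z ^ 2) y = 0 := by
  have hx := ((hu.fun_pow 2).fun_div (hv.fun_pow 2) (pow_ne_zero 2 (hvs ▸ hne))).deriv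
  have hy := ((hr.fun_pow 2).fun_div (hs.fun_pow 2) (pow_ne_zero 2 hne)).deriv
  rw [hx, hy, hur, hvs]
  field_simp
  push_cast
  linear_combination 2 * r y * s y * (s y * hU - r y * hV)


/-- if `A` and `B` solve the second-order linear ODE
`g4 w'' - g4' w' + (g2 g4' - g2' g4 + 4 g0 g4² - g2² g4) w = 0` with `g4`
nonvanishing, and for a solution `w` we set `h̃0 = (g2 w - w')/(2 g4)` and
`V_w(x,y) = (h̃0(x) + w(x) y²)²`, then `H = V_A/V_B`, where `V_B ≠ 0`, is a first
integral of the system `ẋ = -y`, `ẏ = g0(x) + g2(x) y² + g4(x) y⁴`. -/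
theorem stmt_17 (g0 g2 g4 A B : ℝ → ℝ)
    (hg0 : ∀ x, AnalyticAt ℝ g0 x) (hg2 : ∀ x, AnalyticAt ℝ g2 x)
    (hg4 : ∀ x, AnalyticAt ℝ g4 x) (hg4ne : ∀ x, g4 x ≠ 0)
    (hA : ContDiff ℝ 2 A) (hB : ContDiff ℝ 2 B)
    (odeA : ∀ x, g4 x * deriv (deriv A) x - deriv g4 x * deriv A x
        + (g2 x * deriv g4 x - deriv g2 x * g4 x + 4 * g0 x * g4 x ^ 2
            - g2 x ^ 2 * g4 x) * A x = 0)
    (odeB : ∀ x, g4 x * deriv (deriv B) x - deriv g4 x * deriv B x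
        + (g2 x * deriv g4 x - deriv g2 x * g4 x + 4 * g0 x * g4 x ^ 2
            - g2 x ^ 2 * g4 x) * B x = 0) :
    ∀ x y : ℝ,
      ((g2 x * B x - deriv B x) / (2 * g4 x) + B x * y ^ 2) ^ 2 ≠ 0 →
      (-y) * deriv (fun s =>
          ((g2 s * A s - deriv A s) / (2 * g4 s) + A s * y ^ 2) ^ 2
            / ((g2 s * B s - deriv B s) / (2 * g4 s) + B s * y ^ 2) ^ 2) x
        + (g0 x + g2 x * y ^ 2 + g4 x * y ^ 4)
            * deriv (fun t =>
                ((g2 x * A x - deriv A x) / (2 * g4 x) + A x * t ^ 2) ^ 2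
                  / ((g2 x * B x - deriv B x) / (2 * g4 x) + B x * t ^ 2) ^ 2) y
      = 0 := by
 
  intro x y hne
  have hd2 := (hg2 x).differentiableAt
  have hd4 := (hg4 x).differentiableAt
  have h4 := hg4ne x
  refine mul_deriv_sq_div_sq_add_eq_zero (k := y * (g2 x + 2 * g4 x * y ^ 2))
    (hasDerivAt_quadratic_left y hd2 hd4 h4 hA (odeA x))
    (hasDerivAt_quadratic_left y hd2 hd4 h4 hB (odeB x))
    (hasDerivAt_quadratic_right _ _ y) (hasDerivAt_quadratic_right _ _ y)
    rfl rfl (pow_ne_zero_iff two_ne_zero |>.mp hne) ?_ ?_ <;>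
  · field_simp
    ring
end
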